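/- arXiv:1801.00039 — 3 statements merged into one kernel-verified Lean document; each statement's English description precedes it below -/
import Mathlib

section
/- Let λ ∈ ℂ \ {0}, let u, v : ℝ → ℂ with u differentiable, and let ψ : ℝ → ℂ² be differentiable with ψ'(x) = L(x;λ)ψ(x) for all x, where L is the matrix defined in the context. Define Ψ(x) := T(u(x);λ)ψ(x) with T(u;λ) = [[1, 0],[u, λ⁻¹]]. Then Ψ is differentiable and satisfies Ψ'(x) = [Q₁(u,v)(x) + λ²·Q₂(u,v)(x) + (i/4)(λ² − λ⁻²)σ₃]·Ψ(x) for all x ∈ ℝ. -/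
open Complex Matrix

noncomputable def sigma3 : Matrix (Fin 2) (Fin 2) ℂ := !![1, 0; 0, -1]

/-- the Lax matrix L(x;λ) of the massive Thirring model (time frozen) -/
noncomputable def Lmat (u v : ℝ → ℂ) (x : ℝ) (lam : ℂ) : Matrix (Fin 2) (Fin 2) ℂ :=
  (I / 4 * ((‖u x‖ : ℂ) ^ 2 - (‖v x‖ : ℂ) ^ 2)) • sigma3
    - (I * lam / 2) • !![0, starRingEnd ℂ (v x); v x, 0]
    + (I / (2 * lam)) • !![0, starRingEnd ℂ (u x); u x, 0]
    + (I / 4 * (lam ^ 2 - (lam ^ 2)⁻¹)) • sigma3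

/-- the transformation matrix T(u;λ) -/
noncomputable def Tmat (a lam : ℂ) : Matrix (Fin 2) (Fin 2) ℂ := !![1, 0; a, lam⁻¹]

noncomputable def Q1 (u v : ℝ → ℂ) (x : ℝ) : Matrix (Fin 2) (Fin 2) ℂ :=
  !![-(I / 4) * ((‖u x‖ : ℂ) ^ 2 + (‖v x‖ : ℂ) ^ 2), (I / 2) * starRingEnd ℂ (u x);
     deriv u x - (I / 2) * u x * (‖v x‖ : ℂ) ^ 2 - (I / 2) * v x,
       (I / 4) * ((‖u x‖ : ℂ) ^ 2 + (‖v x‖ : ℂ) ^ 2)]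

noncomputable def Q2 (u v : ℝ → ℂ) (x : ℝ) : Matrix (Fin 2) (Fin 2) ℂ :=
  (I / 2) • !![u x * starRingEnd ℂ (v x), -starRingEnd ℂ (v x);
               u x + (u x) ^ 2 * starRingEnd ℂ (v x), -(u x * starRingEnd ℂ (v x))]

/-- The transformation Ψ = T(u;λ)ψ maps solutions of ψ' = Lψ to solutions of
Ψ' = (Q₁ + λ²Q₂ + (i/4)(λ² − λ⁻²)σ₃)Ψ. -/
theorem transformed_spectral_problem_small_lambda
    (lam : ℂ) (hlam : lam ≠ 0) (u v : ℝ → ℂ) (hu : Differentiable ℝ u)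
    (ψ : ℝ → Fin 2 → ℂ)
    (hψ : ∀ x : ℝ, HasDerivAt ψ ((Lmat u v x lam).mulVec (ψ x)) x) :
    ∀ x : ℝ,
      HasDerivAt (fun y => (Tmat (u y) lam).mulVec (ψ y))
        ((Q1 u v x + lam ^ 2 • Q2 u v x
            + (I / 4 * (lam ^ 2 - (lam ^ 2)⁻¹)) • sigma3).mulVec
          ((Tmat (u x) lam).mulVec (ψ x))) x := by
  intro x
  have norm_sq (z : ℂ) : (‖z‖ : ℂ) ^ 2 = z * starRingEnd ℂ z := (Complex.mul_conj' z).symm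
  have hψi := hasDerivAt_pi.1 (hψ x)
  rw [hasDerivAt_pi]
  intro i
  fin_cases i
  · convert hψi 0 using 1
    · ext y
      simp [Tmat, mulVec, dotProduct, Fin.sum_univ_two]
    · simp [Tmat, Lmat, Q1, Q2, sigma3, mulVec, dotProduct, Fin.sum_univ_two, norm_sq]
      field_simp
      ring
  · convert ((hu x).hasDerivAt.mul (hψi 0)).add ((hψi 1).const_mul lam⁻¹) using 1
    · ext y
      simp [Tmat, mulVec, dotProduct, Fin.sum_univ_two]
    · simp [Tmat, Lmat, Q1, Q2, sigma3, mulVec, dotProduct, Fin.sum_univ_two, norm_sq]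
      field_simp
      ring
end

section
/- Let λ ∈ ℂ \ {0}, let u, v : ℝ → ℂ with v differentiable, and let ψ : ℝ → ℂ² be differentiable with ψ'(x) = L(x;λ)ψ(x) for all x, where L is the matrix defined in the context. Define Ψ̂(x) := T̂(v(x);λ)ψ(x) with T̂(v;λ) = [[1, 0],[v, λ]]. Then Ψ̂ is differentiable and satisfies Ψ̂'(x) = [Q̂₁(u,v)(x) + λ⁻²·Q̂₂(u,v)(x) + (i/4)(λ² − λ⁻²)σ₃]·Ψ̂(x) for all x ∈ ℝ. -/
open Complex Matrix

/-- the transformation matrix T̂(v;λ) -/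
noncomputable def Tmat' (a lam : ℂ) : Matrix (Fin 2) (Fin 2) ℂ := !![1, 0; a, lam]

noncomputable def Q1' (u v : ℝ → ℂ) (x : ℝ) : Matrix (Fin 2) (Fin 2) ℂ :=
  !![(I / 4) * ((‖u x‖ : ℂ) ^ 2 + (‖v x‖ : ℂ) ^ 2), -(I / 2) * starRingEnd ℂ (v x);
     deriv v x + (I / 2) * (‖u x‖ : ℂ) ^ 2 * v x + (I / 2) * u x,
       -(I / 4) * ((‖u x‖ : ℂ) ^ 2 + (‖v x‖ : ℂ) ^ 2)]

noncomputable def Q2' (u v : ℝ → ℂ) (x : ℝ) : Matrix (Fin 2) (Fin 2) ℂ :=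
  (-(I / 2)) • !![starRingEnd ℂ (u x) * v x, -starRingEnd ℂ (u x);
                  v x + starRingEnd ℂ (u x) * (v x) ^ 2, -(starRingEnd ℂ (u x) * v x)]

/-- The transformation Ψ̂ = T̂(v;λ)ψ maps solutions of ψ' = Lψ to solutions of
Ψ̂' = (Q̂₁ + λ⁻²Q̂₂ + (i/4)(λ² − λ⁻²)σ₃)Ψ̂. -/
theorem transformed_spectral_problem_large_lambda
    (lam : ℂ) (hlam : lam ≠ 0) (u v : ℝ → ℂ) (hv : Differentiable ℝ v)
    (ψ : ℝ → Fin 2 → ℂ)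
    (hψ : ∀ x : ℝ, HasDerivAt ψ ((Lmat u v x lam).mulVec (ψ x)) x) :
    ∀ x : ℝ,
      HasDerivAt (fun y => (Tmat' (v y) lam).mulVec (ψ y))
        ((Q1' u v x + (lam ^ 2)⁻¹ • Q2' u v x
            + (I / 4 * (lam ^ 2 - (lam ^ 2)⁻¹)) • sigma3).mulVec
          ((Tmat' (v x) lam).mulVec (ψ x))) x := by
  intro x
  have norm_sq (z : ℂ) : (‖z‖ : ℂ) ^ 2 = z * starRingEnd ℂ z := (Complex.mul_conj' z).symm
  have hcomp := hasDerivAt_pi.1 (hψ x)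
  have h0 := hcomp 0
  have h1 := hcomp 1
  have hvx := (hv x).hasDerivAt
  rw [hasDerivAt_pi]
  intro i
  fin_cases i
  · simp only [Tmat', Lmat, Q1', Q2', sigma3, mulVec, dotProduct, Fin.sum_univ_two, norm_sq,
      Fin.zero_eta, Matrix.add_apply, Matrix.sub_apply, Matrix.smul_apply, smul_eq_mul,
      of_apply, cons_val_zero, cons_val_one, one_mul, zero_mul, add_zero] at h0 ⊢
    refine h0.congr_deriv ?_
    field_simp
    ring
  · simp only [Tmat', Lmat, Q1', Q2', sigma3, mulVec, dotProduct, Fin.sum_univ_two, norm_sq,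
      Fin.mk_one, Matrix.add_apply, Matrix.sub_apply, Matrix.smul_apply, smul_eq_mul,
      of_apply, cons_val_zero, cons_val_one] at h0 h1 ⊢
    refine ((hvx.mul h0).add (h1.const_mul lam)).congr_deriv ?_
    field_simp
    ring
end

section
/- Let λ ∈ ℂ \ {0}, let u, v : ℝ → ℂ, and let ψ = (ψ₁, ψ₂) : ℝ → ℂ² be differentiable with ψ'(x) = L(x; conj(λ))·ψ(x) for all x, where L is the matrix defined in the context. Then the function χ(x) := (−conj(ψ₂(x)), conj(ψ₁(x))) is differentiable and satisfies χ'(x) = L(x;λ)·χ(x) for all x ∈ ℝ. -/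
open Complex Matrix

/-- The symmetry of the spectral problem: if ψ solves ψ' = L(x; conj λ)ψ, then
χ = (−conj ψ₂, conj ψ₁) solves χ' = L(x;λ)χ. -/
theorem spectral_problem_symmetry
    (lam : ℂ) (hlam : lam ≠ 0) (u v : ℝ → ℂ)
    (ψ : ℝ → Fin 2 → ℂ)
    (hψ : ∀ x : ℝ, HasDerivAt ψ ((Lmat u v x (starRingEnd ℂ lam)).mulVec (ψ x)) x) :
    ∀ x : ℝ,
      HasDerivAt (fun y => ![-starRingEnd ℂ (ψ y 1), starRingEnd ℂ (ψ y 0)])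
        ((Lmat u v x lam).mulVec ![-starRingEnd ℂ (ψ x 1), starRingEnd ℂ (ψ x 0)]) x := by
  intro x
  have h := hasDerivAt_pi.1 (hψ x)
  have h0 : HasDerivAt (fun y => starRingEnd ℂ (ψ y 0)) _ x := (h 0).star
  have h1 : HasDerivAt (fun y => -starRingEnd ℂ (ψ y 1)) _ x := (h 1).star.neg
  refine hasDerivAt_pi.2 fun i => ?_
  fin_cases i
  · refine h1.congr_deriv ?_
    simp [Lmat, sigma3, Matrix.mulVec, dotProduct, Fin.sum_univ_two]
    ring
  · refine h0.congr_deriv ?_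
    simp [Lmat, sigma3, Matrix.mulVec, dotProduct, Fin.sum_univ_two]
    ring
end
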